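/- arXiv:math/0405290 — 2 statements merged into one kernel-verified Lean document; each statement's English description precedes it below -/
import Mathlib

section
/- Let f : (0, ∞) → (0, ∞) be a finite, positive, convex function which is nonincreasing on (0, a] for some a > 0 and nondecreasing on [b, ∞) for some b ≥ a. Assume the asymptotic elasticity conditions AE_0(f) < ∞ and AE_∞(f) < ∞ hold. Then for all 0 < μ₀ < μ₁ < ∞ there exists a constant C > 0 such that f(μ·y) ≤ C·f(y) for all μ ∈ [μ₀, μ₁] and all y > 0. -/
/-- A convex function has a subgradient at every interior point of its domain. -/
theorem ConvexOn.exists_subgradient_of_mem_interior {f : ℝ → ℝ} {s : Set ℝ} {y : ℝ}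
    (hf : ConvexOn ℝ s f) (hy : y ∈ interior s) :
    ∃ q : ℝ, ∀ z ∈ s, f y + q * (z - y) ≤ f z := by
  refine ⟨derivWithin f (Set.Ioi y) y, fun z hz ↦ ?_⟩
  rcases lt_trichotomy y z with h | rfl | h
  · have hs := hf.rightDeriv_le_slope_of_mem_interior hy hz h
    rw [slope_def_field, le_div_iff₀ (sub_pos.2 h)] at hs
    linarith
  · simp
  · have hs := (hf.slope_le_leftDeriv_of_mem_interior hz hy h).trans
      (hf.leftDeriv_le_rightDeriv_of_mem_interior hy)
    rw [slope_def_field, div_le_iff₀ (sub_pos.2 h)] at hs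
    linarith

/-- On a compact interval inside `(0, ∞)`, the elasticity of a positive convex function is
bounded. -/
theorem ConvexOn.exists_elasticity_le_of_mem_Icc {f : ℝ → ℝ}
    (hf : ConvexOn ℝ (Set.Ioi (0 : ℝ)) f) (hpos : ∀ y : ℝ, 0 < y → 0 < f y)
    {c d : ℝ} (hc : 0 < c) :
    ∃ K : ℝ, ∀ y ∈ Set.Icc c d, ∀ q : ℝ,
      (∀ z : ℝ, 0 < z → f y + q * (z - y) ≤ f z) → |q| * y ≤ K * f y := by
  rcases lt_or_ge d c with hdc | hcd
  · exact ⟨0, fun y hy ↦ absurd (hy.1.trans hy.2) hdc.not_ge⟩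
  have hcont : ContinuousOn f (Set.Icc c d) :=
    (hf.continuousOn isOpen_Ioi).mono fun y hy ↦ hc.trans_le hy.1
  obtain ⟨m, hm, hmin⟩ := isCompact_Icc.exists_isMinOn (Set.nonempty_Icc.2 hcd) hcont
  have hfm : 0 < f m := hpos m (hc.trans_le hm.1)
  have hd : 0 < d := hc.trans_le hcd
  have hfd : 0 < f (d + 1) := hpos _ (by linarith)
  have hfc : 0 < f (c / 2) := hpos _ (by linarith)
  set B := f (d + 1) + f (c / 2) / (c / 2) with hB
  have hfc' : 0 < f (c / 2) / (c / 2) := by positivity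
  have hB0 : 0 < B := by positivity
  refine ⟨B * d / f m, fun y hy q hq ↦ ?_⟩
  have hy0 : 0 < y := hc.trans_le hy.1
  have hfy : 0 < f y := hpos y hy0
  have hqB : |q| ≤ B := by
    refine abs_le.2 ⟨?_, ?_⟩
    · by_contra! h
      have hz := hq (c / 2) (by linarith)
      have hlt : f (c / 2) / (c / 2) < -q := by linarith
      rw [div_lt_iff₀ (by linarith)] at hlt
      have hle : -q * (c / 2) ≤ -q * (y - c / 2) :=
        mul_le_mul_of_nonneg_left (by linarith [hy.1]) (by linarith)
      linarith
    · by_contra! h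
      have hz := hq (d + 1) (by linarith)
      have hle : q * 1 ≤ q * (d + 1 - y) :=
        mul_le_mul_of_nonneg_left (by linarith [hy.2]) (by linarith)
      linarith
  calc |q| * y ≤ B * d := mul_le_mul hqB hy.2 hy0.le hB0.le
    _ = B * d / f m * f m := by field_simp
    _ ≤ B * d / f m * f y := mul_le_mul_of_nonneg_left (hmin hy) (by positivity)

/-- A positive function on `(0, ∞)` with a subgradient of elasticity at most `K` at
`exp t * y` at most doubles from `y` to `exp t * y` when `t` is small compared to `1 / K`. -/
theorem le_two_mul_of_elasticity_le {f : ℝ → ℝ} {K q t y : ℝ} (hK : 0 < K) (hy : 0 < y)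
    (hq : f (Real.exp t * y) + q * (y - Real.exp t * y) ≤ f y)
    (hqK : |q| * (Real.exp t * y) ≤ K * f (Real.exp t * y))
    (ht : |t| ≤ 1) (htK : |t| ≤ 1 / (4 * K)) :
    f (Real.exp t * y) ≤ 2 * f y := by
  set z := Real.exp t * y with hz
  have hz0 : 0 < z := by positivity
  have hyz : y - z = z * (Real.exp (-t) - 1) := by
    rw [hz, Real.exp_neg]
    field_simp
  have hexp : |Real.exp (-t) - 1| ≤ 1 / (2 * K) := by
    have h := Real.abs_exp_sub_one_le (x := -t) (by rwa [abs_neg])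
    rw [abs_neg] at h
    calc |Real.exp (-t) - 1| ≤ 2 * |t| := h
      _ ≤ 2 * (1 / (4 * K)) := by gcongr
      _ = 1 / (2 * K) := by field_simp; norm_num
  have habs : |q * (y - z)| ≤ f z / 2 := by
    calc |q * (y - z)| = |q| * z * |Real.exp (-t) - 1| := by
          rw [hyz, abs_mul, abs_mul, abs_of_pos hz0, ← mul_assoc]
      _ ≤ K * f z * (1 / (2 * K)) :=
          mul_le_mul hqK hexp (abs_nonneg _) ((by positivity : 0 ≤ |q| * z).trans hqK)
      _ = f z / 2 := by field_simp
  linarith [neg_abs_le (q * (y - z))]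


/-- Lemma 2.3(i) — for a positive convex function `f` on `(0, ∞)`,
nonincreasing near `0`, nondecreasing near `∞`, satisfying `AE_0(f) < ∞` and
`AE_∞(f) < ∞`: for all `0 < μ₀ < μ₁` there is `C > 0` with `f (μ y) ≤ C f y`
for all `μ ∈ [μ₀, μ₁]` and `y > 0`. -/
theorem lemma_2_3_i (f : ℝ → ℝ) (a b : ℝ) (ha : 0 < a) (hab : a ≤ b)
    (hconv : ConvexOn ℝ (Set.Ioi (0:ℝ)) f)
    (hpos : ∀ y : ℝ, 0 < y → 0 < f y)
    (hanti : AntitoneOn f (Set.Ioc 0 a))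
    (hmono : MonotoneOn f (Set.Ici b))
    -- `AE_0(f) < ∞`
    (hAE0 : ∃ C > (0:ℝ), ∃ δ > (0:ℝ), ∀ y : ℝ, 0 < y → y < δ →
      ∀ q : ℝ, (∀ z : ℝ, 0 < z → f y + q * (z - y) ≤ f z) → |q| * y ≤ C * f y)
    -- `AE_∞(f) < ∞`
    (hAEinf : ∃ C > (0:ℝ), ∃ y₀ > (0:ℝ), ∀ y : ℝ, y₀ ≤ y →
      ∀ q : ℝ, (∀ z : ℝ, 0 < z → f y + q * (z - y) ≤ f z) → |q| * y ≤ C * f y)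
    (μ₀ μ₁ : ℝ) (hμ₀ : 0 < μ₀) (hμ : μ₀ < μ₁) :
    ∃ C > (0:ℝ), ∀ μ ∈ Set.Icc μ₀ μ₁, ∀ y : ℝ, 0 < y → f (μ * y) ≤ C * f y := by
  obtain ⟨C₀, hC₀, δ, hδ, h₀⟩ := hAE0
  obtain ⟨C₁, -, y₀, -, h₁⟩ := hAEinf
  obtain ⟨C₂, h₂⟩ := hconv.exists_elasticity_le_of_mem_Icc hpos (d := y₀) hδ
  obtain ⟨K, hK, hel⟩ : ∃ K > (0 : ℝ), ∀ y : ℝ, 0 < y → ∀ q : ℝ,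
      (∀ z : ℝ, 0 < z → f y + q * (z - y) ≤ f z) → |q| * y ≤ K * f y := by
    refine ⟨max C₀ (max C₁ C₂), lt_max_of_lt_left hC₀, fun y hy q hq ↦ ?_⟩
    have hfy := (hpos y hy).le
    rcases lt_or_ge y δ with hyδ | hyδ
    · exact (h₀ y hy hyδ q hq).trans (mul_le_mul_of_nonneg_right (by simp) hfy)
    · rcases le_total y₀ y with hyy | hyy
      · exact (h₁ y hyy q hq).trans (mul_le_mul_of_nonneg_right (by simp) hfy)
      · exact (h₂ y ⟨hyδ, hyy⟩ q hq).trans (mul_le_mul_of_nonneg_right (by simp) hfy)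
  have hstep : ∀ t : ℝ, |t| ≤ 1 → |t| ≤ 1 / (4 * K) → ∀ y : ℝ, 0 < y →
      f (Real.exp t * y) ≤ 2 * f y := by
    intro t ht htK y hy
    have hz : 0 < Real.exp t * y := by positivity
    obtain ⟨q, hq⟩ := hconv.exists_subgradient_of_mem_interior (y := Real.exp t * y)
      (by rwa [interior_Ioi])
    exact le_two_mul_of_elasticity_le hK hy (hq y hy) (hel _ hz q hq) ht htK
  have hiter : ∀ t : ℝ, |t| ≤ 1 → |t| ≤ 1 / (4 * K) → ∀ (n : ℕ) (y : ℝ), 0 < y →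
      f (Real.exp (n * t) * y) ≤ 2 ^ n * f y := by
    intro t ht htK n y hy
    induction n with
    | zero => simp
    | succ n ih =>
      have h := hstep t ht htK (Real.exp (n * t) * y) (by positivity)
      rw [← mul_assoc, ← Real.exp_add] at h
      have he : ((n + 1 : ℕ) : ℝ) * t = t + n * t := by push_cast; ring
      rw [he, pow_succ]
      linarith
  set L := max |Real.log μ₀| |Real.log μ₁|
  obtain ⟨n, hn⟩ := exists_nat_gt (max L (L * (4 * K)))
  have hL : 0 ≤ L := (abs_nonneg _).trans (le_max_left _ _)
  have hn0 : (0 : ℝ) < n := hL.trans_lt ((le_max_left _ _).trans_lt hn)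
  refine ⟨2 ^ n, by positivity, fun μ hμI y hy ↦ ?_⟩
  have hμpos : 0 < μ := hμ₀.trans_le hμI.1
  have hlog : |Real.log μ| ≤ L :=
    abs_le_max_abs_abs (Real.log_le_log hμ₀ hμI.1) (Real.log_le_log hμpos hμI.2)
  have habs : |Real.log μ / n| = |Real.log μ| / n := by rw [abs_div, abs_of_pos hn0]
  have h := hiter (Real.log μ / n) ?_ ?_ n y hy
  · rwa [mul_div_cancel₀ _ hn0.ne', Real.exp_log hμpos] at h
  · rw [habs, div_le_one hn0]
    exact hlog.trans ((le_max_left _ _).trans hn.le)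
  · rw [habs, div_le_div_iff₀ hn0 (by positivity), one_mul]
    exact (mul_le_mul_of_nonneg_right hlog (by positivity)).trans
      ((le_max_right _ _).trans hn.le)
end

section
/- Let β ≥ 0 and let U : ℝ → ℝ ∪ {−∞} be a nonconstant, nondecreasing, concave function with U(x) = −∞ for x < −2β, U finite on (−2β, ∞), and U(∞) := lim_{x→∞} U(x) > 0. Let Ũ(y) := sup_{x ∈ ℝ} (U(x) − x·y) be its Fenchel transform, assumed finite on all of (0, ∞), and assume the asymptotic elasticity condition AE_0(Ũ) < ∞. For each integer n ≥ 1 define the quadratic inf-convolution Ũ_n(y) := β·y + inf_{z ≥ 0} (Ũ(z) − β·z + (n/2)·(y − z)²) for y ∈ ℝ (with Ũ(0) := sup_{x∈ℝ} U(x)). Then there exist constants y₀ > 0, γ > 0 and C > 0 such that for all n ≥ 1, all μ ∈ [1/2, 1] and all y ∈ (0, y₀]: Ũ_n(μ·y) − β·μ·y ≤ μ^{−γ}·(C + Ũ_n(y) − β·y). -/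
/-- The Fenchel transform `Ũ(z) = sup_{x > -2β} (U x - x * z)` of a utility function `U`
which equals `-∞` on `(-∞, -2β)` and is finite on `(-2β, ∞)`, with values in the
extended reals (so that `Ũ(0) = sup_x U x`, possibly `+∞`). -/
noncomputable def fenchelBE (β : ℝ) (U : ℝ → ℝ) (z : ℝ) : EReal :=
  ⨆ x ∈ Set.Ioi (-(2*β)), ((U x - x * z : ℝ) : EReal)

/-- The real-valued Fenchel transform (meaningful for `y > 0` where it is finite). -/
noncomputable def fenchelB (β : ℝ) (U : ℝ → ℝ) (y : ℝ) : ℝ :=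
  sSup ((fun x => U x - x * y) '' Set.Ioi (-(2*β)))

/-- The quadratic inf-convolution
`Ũ_n(y) := βy + inf_{z ≥ 0} (Ũ(z) - βz + (n/2)(y - z)²)`
(the infimum is taken in the extended reals and is in fact finite). -/
noncomputable def infConvB (β : ℝ) (U : ℝ → ℝ) (n : ℕ) (y : ℝ) : ℝ :=
  β * y + (⨅ z ∈ Set.Ici (0:ℝ),
    (fenchelBE β U z + (((n:ℝ)/2 * (y - z)^2 - β * z : ℝ) : EReal))).toReal

open Set

/-- A finite convex function on an open set has a subgradient at every point. -/
theorem ConvexOn.exists_subgradient {S : Set ℝ} {f : ℝ → ℝ} (hf : ConvexOn ℝ S f)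
    {x : ℝ} (hx : x ∈ interior S) : ∃ q : ℝ, ∀ z ∈ S, f x + q * (z - x) ≤ f z := by
  refine ⟨derivWithin f (Ioi x) x, fun z hz => ?_⟩
  rcases lt_trichotomy x z with h | rfl | h
  · have := hf.rightDeriv_le_slope_of_mem_interior hx hz h
    rw [slope_def_field, le_div_iff₀ (sub_pos.2 h)] at this
    linarith
  · simp
  · have := (hf.slope_le_leftDeriv_of_mem_interior hz hx h).trans
      (hf.leftDeriv_le_rightDeriv_of_mem_interior hx)
    rw [slope_def_field, div_le_iff₀ (sub_pos.2 h)] at this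
    linarith

/-- A convex function grows at most linearly backwards: its secant slopes to the right of `a`
are bounded below. -/
theorem ConvexOn.exists_forall_le_add_mul {f : ℝ → ℝ} (hf : ConvexOn ℝ (Ioi 0) f)
    {a : ℝ} (ha : 0 < a) :
    ∃ p : ℝ, ∀ x z : ℝ, a < x → x ≤ z → f x + p * (z - x) ≤ f z := by
  have hint : ∀ {x : ℝ}, 0 < x → x ∈ interior (Ioi (0 : ℝ)) := fun hx => by
    rwa [interior_Ioi]
  obtain ⟨p, hp⟩ := hf.exists_subgradient (hint ha)
  refine ⟨p, fun x z hax hxz => ?_⟩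
  have hx : 0 < x := ha.trans hax
  obtain ⟨q, hq⟩ := hf.exists_subgradient (hint hx)
  have h1 := hp x hx
  have h2 := hq a ha
  have h3 := hq z (hx.trans_le hxz)
  have hpq : p ≤ q := by
    have : 0 ≤ (q - p) * (x - a) := by linarith
    have := nonneg_of_mul_nonneg_left this (sub_pos.2 hax)
    linarith
  have := mul_le_mul_of_nonneg_right hpq (sub_nonneg.2 hxz)
  linarith

section Fenchel

variable {β : ℝ} {U : ℝ → ℝ}

theorem le_fenchelB {y : ℝ} (h : BddAbove ((fun x => U x - x * y) '' Ioi (-(2*β))))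
    {x : ℝ} (hx : x ∈ Ioi (-(2*β))) : U x - x * y ≤ fenchelB β U y :=
  le_csSup h (mem_image_of_mem _ hx)

theorem le_fenchelBE (z : ℝ) {x : ℝ} (hx : x ∈ Ioi (-(2*β))) :
    ((U x - x * z : ℝ) : EReal) ≤ fenchelBE β U z :=
  le_iSup₂ (f := fun x (_ : x ∈ Ioi (-(2*β))) => ((U x - x * z : ℝ) : EReal)) x hx

theorem fenchelBE_eq_coe {y : ℝ} (h : BddAbove ((fun x => U x - x * y) '' Ioi (-(2*β)))) :
    fenchelBE β U y = (fenchelB β U y : EReal) := by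
  have hne : ((fun x => U x - x * y) '' Ioi (-(2*β))).Nonempty := nonempty_Ioi.image _
  apply le_antisymm
  · exact iSup₂_le fun x hx => EReal.coe_le_coe_iff.2 (le_fenchelB h hx)
  · refine EReal.le_of_forall_lt_iff_le.1 fun r hr => ?_
    by_contra hlt
    obtain ⟨_, ⟨x, hx, rfl⟩, hxr⟩ := exists_lt_of_lt_csSup hne
      (EReal.coe_lt_coe_iff.1 (not_le.1 hlt))
    exact absurd ((le_fenchelBE y hx).trans_lt hr) (not_lt.2 (EReal.coe_le_coe_iff.2 hxr.le))

theorem convexOn_fenchelB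
    (hfin : ∀ y : ℝ, 0 < y → BddAbove ((fun x => U x - x * y) '' Ioi (-(2*β)))) :
    ConvexOn ℝ (Ioi 0) (fenchelB β U) := by
  refine ⟨convex_Ioi 0, fun y hy z hz a b ha hb hab => ?_⟩
  refine csSup_le (nonempty_Ioi.image _) ?_
  rintro _ ⟨x, hx, rfl⟩
  have h1 := mul_le_mul_of_nonneg_left (le_fenchelB (hfin y hy) hx) ha
  have h2 := mul_le_mul_of_nonneg_left (le_fenchelB (hfin z hz) hx) hb
  have h3 : U x = a * U x + b * U x := by rw [← add_mul, hab, one_mul]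
  simp only [smul_eq_mul]
  linarith

end Fenchel

/-- `1 - C (ν⁻¹ - 1)` dominates `ν ^ (2C)` for `ν = (1 + t)⁻¹` close to `1`. -/
theorem one_le_one_sub_mul_rpow {C t : ℝ} (hC : 1 ≤ C) (ht : 0 ≤ t) (htC : 2 * C * t ≤ 1) :
    1 ≤ (1 - C * t) * (1 + t) ^ (2 * C) := by
  have h := one_add_mul_self_le_rpow_one_add (by linarith : -1 ≤ t) (by linarith : 1 ≤ 2 * C)
  calc (1 : ℝ) ≤ (1 - C * t) * (1 + 2 * C * t) := by
        nlinarith [mul_nonneg (mul_nonneg (by linarith : 0 ≤ C) ht) (sub_nonneg.2 htC)]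
    _ ≤ _ := mul_le_mul_of_nonneg_left h (by linarith)

/-- The elasticity bound `|q| y ≤ C f y` on subgradients integrates to a power growth bound. -/
theorem ConvexOn.le_rpow_mul_of_elasticity {f : ℝ → ℝ} (hf : ConvexOn ℝ (Ioi 0) f)
    {C δ : ℝ} (hC : 1 ≤ C) (hpos : ∀ y, 0 < y → y < δ → 0 ≤ f y)
    (hAE : ∀ y, 0 < y → y < δ → ∀ q : ℝ,
      (∀ z, 0 < z → f y + q * (z - y) ≤ f z) → |q| * y ≤ C * f y)
    {μ z : ℝ} (hμ : 0 < μ) (hμ1 : μ ≤ 1) (hz : 0 < z) (hzδ : z < δ) :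
    f (μ * z) ≤ μ ^ (-(2 * C)) * f z := by
  have hC0 : 0 < C := by linarith
  have base : ∀ t : ℝ, 0 ≤ t → 2 * C * t ≤ 1 → ∀ y, 0 < y → (1 + t) * y < δ →
      f y ≤ (1 + t) ^ (2 * C) * f ((1 + t) * y) := by
    intro t ht htC y hy hyδ
    have hyy : y ≤ (1 + t) * y := by nlinarith
    obtain ⟨q, hq⟩ := hf.exists_subgradient (x := y) (by rwa [interior_Ioi])
    have hq1 := hAE y hy (hyy.trans_lt hyδ) q hq
    have hq2 := hq ((1 + t) * y) (hy.trans_le hyy)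
    have hfy := hpos y hy (hyy.trans_lt hyδ)
    have h3 : (1 - C * t) * f y ≤ f ((1 + t) * y) := by
      have : -(q * y) ≤ |q| * y := by
        nlinarith [neg_abs_le q]
      nlinarith
    have hp : 0 < (1 + t) ^ (2 * C) := Real.rpow_pos_of_pos (by linarith) _
    calc f y ≤ ((1 - C * t) * (1 + t) ^ (2 * C)) * f y :=
          le_mul_of_one_le_left hfy (one_le_one_sub_mul_rpow hC ht htC)
      _ = (1 + t) ^ (2 * C) * ((1 - C * t) * f y) := by ring
      _ ≤ _ := mul_le_mul_of_nonneg_left h3 hp.le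
  set s : ℝ := 1 / (2 * C) with hs
  have hs0 : 0 < s := by positivity
  have hsC : 2 * C * s = 1 := by rw [hs]; field_simp
  have iter : ∀ k : ℕ, ∀ r : ℝ, 1 ≤ r → r ≤ (1 + s) ^ k → ∀ y, 0 < y → r * y < δ →
      f y ≤ r ^ (2 * C) * f (r * y) := by
    intro k
    induction k with
    | zero =>
      intro r hr1 hr y _ _
      obtain rfl : r = 1 := le_antisymm (by simpa using hr) hr1
      simp
    | succ k ih =>
      intro r hr1 hr y hy hyδ
      rcases le_total r (1 + s) with h | h
      · have := base (r - 1) (by linarith) (by nlinarith) y hy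
        simpa using this (by simpa using hyδ)
      · have hs1 : 0 < 1 + s := by linarith
        have hry : r / (1 + s) * ((1 + s) * y) = r * y := by field_simp
        have hr1' : 1 ≤ r / (1 + s) := (one_le_div hs1).2 h
        have h2 := ih (r / (1 + s)) hr1'
          ((div_le_iff₀ hs1).2 (by rwa [pow_succ] at hr)) ((1 + s) * y) (by positivity)
          (by rwa [hry])
        have h1 := base s hs0.le hsC.le y hy (by nlinarith)
        rw [hry] at h2
        have hrr : r = (1 + s) * (r / (1 + s)) := by field_simp
        calc f y ≤ (1 + s) ^ (2 * C) * f ((1 + s) * y) := h1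
          _ ≤ (1 + s) ^ (2 * C) * ((r / (1 + s)) ^ (2 * C) * f (r * y)) :=
            mul_le_mul_of_nonneg_left h2 (by positivity)
          _ = ((1 + s) * (r / (1 + s))) ^ (2 * C) * f (r * y) := by
            rw [Real.mul_rpow hs1.le (by linarith)]; ring
          _ = _ := by rw [← hrr]
  obtain ⟨k, hk⟩ := pow_unbounded_of_one_lt μ⁻¹ (by linarith : 1 < 1 + s)
  have hz' : μ⁻¹ * (μ * z) = z := by field_simp
  have := iter k μ⁻¹ ((one_le_inv₀ hμ).2 hμ1) hk.le (μ * z) (by positivity) (by rwa [hz'])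
  rwa [hz', Real.inv_rpow hμ.le, ← Real.rpow_neg hμ.le] at this

/-- Pointwise comparison of the penalized objectives under the scaling `z ↦ μ z`
away from the origin. -/
theorem penalized_scaling_of_large {A K C N μ m y z v w β : ℝ} (hK : 0 ≤ K)
    (hC : 2 * (A + K) ^ 2 ≤ C) (hN : 1 ≤ N) (hμ0 : 0 < μ) (hμ1 : μ ≤ 1) (hm : 2 - μ ≤ m)
    (hz : 0 < z) (hyz : 2 * y ≤ z)
    (hv : -(A * z) ≤ v - β * z) (hw : w - β * (μ * z) ≤ v - β * z + K * ((1 - μ) * z)) :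
    w + (N / 2 * (μ * y - μ * z) ^ 2 - β * (μ * z)) ≤
      m * (C + (v + (N / 2 * (y - z) ^ 2 - β * z))) := by
  have hm1 : 0 ≤ m - 1 := by linarith
  have hD : z ^ 2 / 4 ≤ (y - z) ^ 2 := by nlinarith
  have h1 : (m - 1) * -(A * z) ≤ (m - 1) * (v - β * z) := mul_le_mul_of_nonneg_left hv hm1
  have h2 : K * ((1 - μ) * z) ≤ K * ((m - 1) * z) :=
    mul_le_mul_of_nonneg_left (mul_le_mul_of_nonneg_right (by linarith) hz.le) hK
  have hND : z ^ 2 / 8 ≤ N / 2 * (y - z) ^ 2 := by nlinarith [sq_nonneg (y - z)]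
  have hμ2 : μ ^ 2 ≤ 1 := by nlinarith
  have h3 : (m - 1) * (z ^ 2 / 8) ≤ (m - μ ^ 2) * (N / 2 * (y - z) ^ 2) :=
    mul_le_mul (by linarith) hND (by positivity) (by linarith)
  have h4 : (m - 1) * ((A + K) * z) ≤ (m - 1) * (z ^ 2 / 8 + 2 * (A + K) ^ 2) :=
    mul_le_mul_of_nonneg_left (by nlinarith [sq_nonneg (z - 4 * (A + K))]) hm1
  have h5 : (m - 1) * (2 * (A + K) ^ 2) ≤ m * C := by
    nlinarith [sq_nonneg (A + K)]
  have e : (μ * y - μ * z) ^ 2 = μ ^ 2 * (y - z) ^ 2 := by ring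
  rw [e]
  linarith

/-- Pointwise comparison of the penalized objectives under the scaling `z ↦ μ z`
near the origin. -/
theorem penalized_scaling_of_small {C N μ m y z v w β : ℝ} (hβ : 0 ≤ β)
    (hC : β * z ≤ C) (hN : 0 ≤ N) (hμ0 : 0 < μ) (hμ1 : μ ≤ 1) (hm : 1 ≤ m)
    (hz : 0 ≤ z) (hw : w ≤ m * v) :
    w + (N / 2 * (μ * y - μ * z) ^ 2 - β * (μ * z)) ≤
      m * (C + (v + (N / 2 * (y - z) ^ 2 - β * z))) := by
  have hμ2 : μ ^ 2 ≤ 1 := by nlinarith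
  have h1 : μ ^ 2 * (N / 2 * (y - z) ^ 2) ≤ m * (N / 2 * (y - z) ^ 2) :=
    mul_le_mul_of_nonneg_right (by linarith) (by positivity)
  have h2 : 0 ≤ m * (C - β * z) := mul_nonneg (by linarith) (by linarith)
  have h3 : 0 ≤ β * (μ * z) := by positivity
  have e : (μ * y - μ * z) ^ 2 = μ ^ 2 * (y - z) ^ 2 := by ring
  rw [e]
  linarith

/-- The infimum defining `infConvB` is a real number. -/
theorem exists_iInf_eq_coe {β : ℝ} {U : ℝ → ℝ}
    (hfin : ∀ y : ℝ, 0 < y → BddAbove ((fun x => U x - x * y) '' Ioi (-(2*β))))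
    {n : ℕ} (hn : 1 ≤ n) (y : ℝ) :
    ∃ r : ℝ, (⨅ z ∈ Ici (0:ℝ),
      (fenchelBE β U z + (((n:ℝ)/2 * (y - z)^2 - β * z : ℝ) : EReal))) = (r : EReal) := by
  obtain ⟨x, hx⟩ : (Ioi (-(2*β))).Nonempty := nonempty_Ioi
  have hn' : (1 : ℝ) ≤ n := by exact_mod_cast hn
  have hlow : ((U x - (x + β) * y - (x + β) ^ 2 / 2 : ℝ) : EReal) ≤ ⨅ z ∈ Ici (0:ℝ),
      (fenchelBE β U z + (((n:ℝ)/2 * (y - z)^2 - β * z : ℝ) : EReal)) := by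
    refine le_iInf₂ fun z _ => ?_
    refine le_trans ?_ (add_le_add_left (le_fenchelBE z hx) _)
    rw [← EReal.coe_add, EReal.coe_le_coe_iff]
    nlinarith [sq_nonneg (z - y - (x + β)), mul_nonneg (sub_nonneg.2 hn') (sq_nonneg (y - z))]
  have hup : (⨅ z ∈ Ici (0:ℝ),
      (fenchelBE β U z + (((n:ℝ)/2 * (y - z)^2 - β * z : ℝ) : EReal))) ≤
      ((fenchelB β U 1 + ((n:ℝ)/2 * (y - 1)^2 - β * 1) : ℝ) : EReal) := by
    refine (iInf₂_le (1 : ℝ) (by simp)).trans ?_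
    rw [fenchelBE_eq_coe (hfin 1 one_pos), EReal.coe_add]
  exact ⟨_, (EReal.coe_toReal (hup.trans_lt (EReal.coe_lt_top _)).ne
    ((EReal.bot_lt_coe _).trans_le hlow).ne').symm⟩

/-- A pointwise comparison of the penalized objectives along `z ↦ μ z` passes to the
inf-convolutions. -/
theorem infConvB_scaling {β : ℝ} {U : ℝ → ℝ}
    (hfin : ∀ y : ℝ, 0 < y → BddAbove ((fun x => U x - x * y) '' Ioi (-(2*β))))
    {n : ℕ} (hn : 1 ≤ n) {μ m y C : ℝ} (hμ : 0 < μ) (hm : 0 < m)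
    (h : ∀ z : ℝ, 0 ≤ z → ∀ v : ℝ, fenchelBE β U z = (v : EReal) →
      ∃ w : ℝ, fenchelBE β U (μ * z) = (w : EReal) ∧
        w + ((n : ℝ) / 2 * (μ * y - μ * z) ^ 2 - β * (μ * z)) ≤
          m * (C + (v + ((n : ℝ) / 2 * (y - z) ^ 2 - β * z)))) :
    infConvB β U n (μ * y) - β * (μ * y) ≤ m * (C + infConvB β U n y - β * y) := by
  obtain ⟨a, ha⟩ := exists_iInf_eq_coe hfin hn (μ * y)
  obtain ⟨b, hb⟩ := exists_iInf_eq_coe hfin hn y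
  rw [infConvB, infConvB, ha, hb, EReal.toReal_coe, EReal.toReal_coe]
  have key : ∀ r, b < r → a ≤ m * (C + r) := by
    intro r hr
    have hr' : (b : EReal) < r := EReal.coe_lt_coe_iff.2 hr
    rw [← hb] at hr'
    simp only [iInf_lt_iff] at hr'
    obtain ⟨z, hz, hzr⟩ := hr'
    obtain ⟨x, hx⟩ : (Ioi (-(2*β))).Nonempty := nonempty_Ioi
    have hbot : fenchelBE β U z ≠ ⊥ := ((EReal.bot_lt_coe _).trans_le (le_fenchelBE z hx)).ne'
    have htop : fenchelBE β U z ≠ ⊤ := by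
      intro ht
      rw [ht, EReal.top_add_coe] at hzr
      exact not_top_lt hzr
    have hv := (EReal.coe_toReal htop hbot).symm
    obtain ⟨w, hw, hle⟩ := h z hz _ hv
    rw [hv, ← EReal.coe_add, EReal.coe_lt_coe_iff] at hzr
    have hup : (a : EReal) ≤
        ((w + ((n : ℝ) / 2 * (μ * y - μ * z) ^ 2 - β * (μ * z)) : ℝ) : EReal) := by
      rw [← ha]
      refine (iInf₂_le (μ * z) (mul_nonneg hμ.le hz)).trans ?_
      rw [hw, EReal.coe_add]
    refine (EReal.coe_le_coe_iff.1 hup).trans (hle.trans ?_)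
    gcongr
  have : a / m - C ≤ b := le_of_forall_gt_imp_ge_of_dense fun r hr => by
    have := key r hr
    rw [sub_le_iff_le_add, div_le_iff₀ hm]
    linarith
  rw [sub_le_iff_le_add, div_le_iff₀ hm] at this
  linarith

/-- Property 6.4 (first inequality) — under `AE_0(Ũ) < ∞` there are
`y₀ > 0`, `γ > 0`, `C > 0` with `Ũ_n(μy) - βμy ≤ μ^{-γ} (C + Ũ_n(y) - βy)` for all
`n ≥ 1`, `μ ∈ [1/2, 1]` and `y ∈ (0, y₀]`. -/
theorem property_6_4_first (β : ℝ) (hβ : 0 ≤ β) (U : ℝ → ℝ)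
    (hconc : ConcaveOn ℝ (Set.Ioi (-(2*β))) U)
    (hmono : MonotoneOn U (Set.Ioi (-(2*β))))
    -- `U(∞) > 0`
    (hUpos : ∃ x ∈ Set.Ioi (-(2*β)), 0 < U x)
    -- `Ũ` is finite on `(0, ∞)`
    (hfin : ∀ y : ℝ, 0 < y → BddAbove ((fun x => U x - x * y) '' Set.Ioi (-(2*β))))
    -- `AE_0(Ũ) < ∞`
    (hAE : ∃ C > (0:ℝ), ∃ δ > (0:ℝ), ∀ y : ℝ, 0 < y → y < δ →
      ∀ q : ℝ, (∀ z : ℝ, 0 < z → fenchelB β U y + q * (z - y) ≤ fenchelB β U z) →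
        |q| * y ≤ C * fenchelB β U y) :
    ∃ y₀ > (0:ℝ), ∃ γ > (0:ℝ), ∃ C > (0:ℝ), ∀ n : ℕ, 1 ≤ n →
      ∀ μ ∈ Set.Icc (1/2 : ℝ) 1, ∀ y : ℝ, 0 < y → y ≤ y₀ →
        infConvB β U n (μ * y) - β * (μ * y) ≤ μ ^ (-γ) * (C + infConvB β U n y - β * y) := by
  obtain ⟨x₀, hx₀, hUx₀⟩ := hUpos
  obtain ⟨C₀, hC₀, δ₀, hδ₀, hAE⟩ := hAE
  have hconv := convexOn_fenchelB hfin
  set δ : ℝ := min δ₀ (U x₀ / (|x₀| + 1))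
  have hδ : 0 < δ := lt_min hδ₀ (by positivity)
  have hpos : ∀ y, 0 < y → y < δ → 0 ≤ fenchelB β U y := by
    intro y hy hyδ
    refine le_trans ?_ (le_fenchelB (hfin y hy) hx₀)
    have h1 := (lt_div_iff₀ (by positivity)).1 (hyδ.trans_le (min_le_right _ _))
    nlinarith [le_abs_self x₀]
  set C₁ : ℝ := max C₀ 1
  have hC₁ : 1 ≤ C₁ := le_max_right _ _
  have hgrow : ∀ μ z : ℝ, 0 < μ → μ ≤ 1 → 0 < z → z < δ →
      fenchelB β U (μ * z) ≤ μ ^ (-(2 * C₁)) * fenchelB β U z := by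
    intro μ z hμ hμ1 hz hzδ
    refine hconv.le_rpow_mul_of_elasticity hC₁ hpos (fun y hy hyδ q hq => ?_) hμ hμ1 hz hzδ
    exact (hAE y hy (hyδ.trans_le (min_le_left _ _)) q hq).trans
      (mul_le_mul_of_nonneg_right (le_max_left _ _) (hpos y hy hyδ))
  obtain ⟨p, hp⟩ := hconv.exists_forall_le_add_mul (a := δ / 4) (by positivity)
  set A : ℝ := |x₀ + β|
  set K : ℝ := |β - p|
  refine ⟨δ / 2, by positivity, 2 * C₁, by positivity, 2 * (A + K) ^ 2 + β * δ + 1,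
    by positivity, ?_⟩
  rintro n hn μ ⟨hμ, hμ1⟩ y hy hyδ
  have hn' : (1 : ℝ) ≤ n := by exact_mod_cast hn
  have hμ0 : 0 < μ := by linarith
  have hm : 2 - μ ≤ μ ^ (-(2 * C₁)) := by
    calc 2 - μ ≤ μ ^ (-1 : ℝ) := by
          rw [Real.rpow_neg_one, inv_eq_one_div, le_div_iff₀ hμ0]
          nlinarith [sq_nonneg (μ - 1)]
      _ ≤ _ := Real.rpow_le_rpow_of_exponent_ge hμ0 hμ1 (by linarith)
  have hm1 : 1 ≤ μ ^ (-(2 * C₁)) := by linarith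
  have hβδ : 0 ≤ β * δ := by positivity
  refine infConvB_scaling hfin hn hμ0 (by linarith) fun z hz v hv => ?_
  rcases hz.eq_or_lt with rfl | hz
  · refine ⟨v, by rwa [mul_zero], ?_⟩
    have hv0 : 0 ≤ v := by
      have := le_fenchelBE (U := U) 0 hx₀
      rw [hv, EReal.coe_le_coe_iff] at this
      linarith
    exact penalized_scaling_of_small hβ (by rw [mul_zero]; positivity) (by linarith) hμ0 hμ1 hm1
      le_rfl (le_mul_of_one_le_left hv0 hm1)
  · obtain rfl : fenchelB β U z = v := by
      rwa [fenchelBE_eq_coe (hfin z hz), EReal.coe_eq_coe_iff] at hv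
    refine ⟨_, fenchelBE_eq_coe (hfin (μ * z) (by positivity)), ?_⟩
    rcases lt_or_ge z δ with hzδ | hzδ
    · refine penalized_scaling_of_small hβ ?_ (by linarith) hμ0 hμ1 hm1 hz.le
        (hgrow μ z hμ0 hμ1 hz hzδ)
      have := mul_le_mul_of_nonneg_left hzδ.le hβ
      nlinarith [sq_nonneg (A + K)]
    · refine penalized_scaling_of_large (A := A) (K := K) (abs_nonneg _)
        (by linarith) hn' hμ0 hμ1 hm hz (by linarith) ?_ ?_
      · have h1 := le_fenchelB (hfin z hz) hx₀
        have h2 := mul_le_mul_of_nonneg_right (le_abs_self (x₀ + β)) hz.le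
        linarith
      · have h1 := hp (μ * z) z (by nlinarith) (by nlinarith)
        have h2 := mul_le_mul_of_nonneg_right (le_abs_self (β - p))
          (mul_nonneg (sub_nonneg.2 hμ1) hz.le)
        linarith
end
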